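/- Control of the random Gram-type matrix for piecewise polynomials: under the assumptions of the sup-norm consistency lemma for piecewise polynomials (|Y| ≤ A a.s.; 𝒳=[0,1]; c_min ≤ f ≤ c_max; √(|𝒫|·inf_I Leb(I)) ≥ c_{M,Leb}; D ≤ A_+ n(ln n)^{−2}), let {φ_{I_k,j}} be the localized orthonormal basis of M and let L_{n,D} be the D×D matrix with entries (L_{n,D})_{(I_k,j),(I_l,i)} = (P_n − P)(φ_{I_k,j}·φ_{I_l,i}), and let ‖·‖ be the operator norm induced by the sup-norm on vectors. Then for every γ>0 there exists n_0(r,A_+,c_min,c_{M,Leb},γ) such that for all n ≥ n_0, on an event Ω_n of probability at least 1 − 3Dn^{−γ}: (i) ‖L_{n,D}‖ ≤ L·√(D ln n/n) ≤ 1/2; (ii) for all k, max_{j∈{0,…,r}} Σ_{i=0}^r |(P_n − P)(φ_{I_k,j}·φ_{I_k,i})| ≤ L·√(ln n/(n·Leb(I_k))) ≤ 1/2; (iii) for all k, max_{j∈{0,…,r}} |(P_n − P)(y·φ_{I_k,j}(x))| ≤ L'·√(ln n/n); here L depends only on r, A_+, c_min, c_{M,Leb}, γ and L' depends only on A, A_+,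 r, c_min, c_{M,Leb}, γ. -/

import Mathlib

open MeasureTheory

/-- An exponential moment bound for an almost surely bounded random variable. -/
lemma integral_exp_mul_le_of_ae_abs_le {Z : Type*} [MeasurableSpace Z] (P : Measure Z)
    [IsProbabilityMeasure P] {g : Z → ℝ} (hg : AEStronglyMeasurable g P) {B v t : ℝ}
    (hB : ∀ᵐ z ∂P, |g z| ≤ B) (hv : ∫ z, g z ^ 2 ∂P ≤ v) (ht : 0 ≤ t) (htB : t * B ≤ 1) :
    Integrable (fun z => Real.exp (t * g z)) P ∧
      ∫ z, Real.exp (t * g z) ∂P ≤ Real.exp (t * ∫ z, g z ∂P + t ^ 2 * v) := by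
  have hgi : Integrable g P := .of_bound hg B (by simpa using hB)
  have hg2 : Integrable (fun z => g z ^ 2) P := by
    refine .of_bound (hg.pow 2) (B ^ 2) ?_
    filter_upwards [hB] with z hz
    rw [Real.norm_eq_abs, abs_pow]
    exact pow_le_pow_left₀ (abs_nonneg _) hz 2
  have hsmall : ∀ᵐ z ∂P, |t * g z| ≤ 1 := by
    filter_upwards [hB] with z hz
    rw [abs_mul, abs_of_nonneg ht]
    exact (mul_le_mul_of_nonneg_left hz ht).trans htB
  have hexp : Integrable (fun z => Real.exp (t * g z)) P := by
    refine .of_bound (Real.continuous_exp.comp_aestronglyMeasurable (hg.const_mul t))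
      (Real.exp 1) ?_
    filter_upwards [hsmall] with z hz
    rw [Real.norm_eq_abs, abs_of_pos (Real.exp_pos _)]
    exact Real.exp_le_exp.mpr ((le_abs_self _).trans hz)
  refine ⟨hexp, ?_⟩
  have hlin : Integrable (fun z => 1 + t * g z) P := (integrable_const 1).add (hgi.const_mul t)
  calc ∫ z, Real.exp (t * g z) ∂P
      ≤ ∫ z, (1 + t * g z + t ^ 2 * g z ^ 2) ∂P := by
        refine integral_mono_ae hexp (hlin.add (hg2.const_mul _)) ?_
        filter_upwards [hsmall] with z hz
        have := (le_abs_self _).trans (Real.abs_exp_sub_one_sub_id_le hz)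
        linarith [mul_pow t (g z) 2]
    _ = 1 + t * ∫ z, g z ∂P + t ^ 2 * ∫ z, g z ^ 2 ∂P := by
        rw [integral_add hlin (hg2.const_mul _), integral_add (integrable_const 1)
          (hgi.const_mul t), integral_const_mul, integral_const_mul]
        simp
    _ ≤ t * ∫ z, g z ∂P + t ^ 2 * v + 1 := by
        linarith [mul_le_mul_of_nonneg_left hv (sq_nonneg t)]
    _ ≤ _ := Real.add_one_le_exp _

/-- One-sided Bernstein inequality for the empirical measure, in the sub-Gaussian regime
`B ^ 2 * x ≤ n * v`. -/
lemma pi_real_le_exp_neg_of_ae_abs_le {Z : Type*} [MeasurableSpace Z] (P : Measure Z)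
    [IsProbabilityMeasure P] {g : Z → ℝ} (hg : AEStronglyMeasurable g P) {B v x : ℝ} {n : ℕ}
    (hn : 0 < n) (hB : ∀ᵐ z ∂P, |g z| ≤ B) (hv : ∫ z, g z ^ 2 ∂P ≤ v) (hv0 : 0 < v)
    (hx : 0 ≤ x) (hBx : B ^ 2 * x ≤ n * v) :
    (Measure.pi fun _ : Fin n => P).real
      {ω | 2 * Real.sqrt (x * v / n) ≤ (n : ℝ)⁻¹ * ∑ i, g (ω i) - ∫ z, g z ∂P}
      ≤ Real.exp (-x) := by
  have hn' : (0 : ℝ) < n := by exact_mod_cast hn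
  set t := Real.sqrt (x / (n * v)) with ht_def
  have ht : 0 ≤ t := Real.sqrt_nonneg _
  have ht2 : t ^ 2 = x / (n * v) := Real.sq_sqrt (by positivity)
  have htB : t * B ≤ 1 := by
    refine (le_abs_self _).trans (abs_le_one_iff_mul_self_le_one.mpr ?_)
    have : t * B * (t * B) = B ^ 2 * x / (n * v) := by
      rw [show t * B * (t * B) = t ^ 2 * B ^ 2 by ring, ht2]; ring
    rw [this]
    exact (div_le_one (by positivity)).mpr hBx
  have hts : t * Real.sqrt (x * v / n) = x / n := by
    rw [ht_def, ← Real.sqrt_mul (by positivity),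
      show x / (n * v) * (x * v / n) = (x / n) ^ 2 by field_simp]
    exact Real.sqrt_sq (by positivity)
  obtain ⟨hint, hmgf⟩ := integral_exp_mul_le_of_ae_abs_le P hg hB hv ht htB
  set m := ∫ z, g z ∂P
  have hprod : (fun ω : Fin n → Z => Real.exp (t * ∑ i, g (ω i)))
      = fun ω => ∏ i, Real.exp (t * g (ω i)) := by
    funext ω
    rw [Finset.mul_sum, Real.exp_sum]
  have hchern := ProbabilityTheory.measure_ge_le_exp_mul_mgf
    (μ := Measure.pi fun _ : Fin n => P) (X := fun ω => ∑ i, g (ω i)) (t := t)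
    (n * (m + 2 * Real.sqrt (x * v / n))) ht (by
      rw [hprod]
      exact Integrable.fintype_prod (f := fun _ z => Real.exp (t * g z)) fun _ => hint)
  have hmgf_eq : ProbabilityTheory.mgf (fun ω : Fin n → Z => ∑ i, g (ω i))
      (Measure.pi fun _ : Fin n => P) t = (∫ z, Real.exp (t * g z) ∂P) ^ n := by
    rw [ProbabilityTheory.mgf, hprod,
      integral_fintype_prod_eq_prod (f := fun _ z => Real.exp (t * g z))]
    simp
  have hset : {ω : Fin n → Z | 2 * Real.sqrt (x * v / n) ≤ (n : ℝ)⁻¹ * ∑ i, g (ω i) - m}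
      = {ω | n * (m + 2 * Real.sqrt (x * v / n)) ≤ ∑ i, g (ω i)} := by
    ext ω
    simp only [Set.mem_ofPred_eq]
    rw [le_sub_iff_add_le, add_comm, inv_mul_eq_div, le_div_iff₀ hn', mul_comm]
  rw [hset]
  refine hchern.trans ?_
  rw [hmgf_eq]
  calc _ ≤ Real.exp (-t * (n * (m + 2 * Real.sqrt (x * v / n))))
        * Real.exp (t * m + t ^ 2 * v) ^ n := by gcongr
    _ = Real.exp (-x) := by
      rw [← Real.exp_nat_mul, ← Real.exp_add, ht2]
      congr 1
      have e1 : -t * (n * (m + 2 * Real.sqrt (x * v / n)))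
          = -(t * n * m) - 2 * n * (t * Real.sqrt (x * v / n)) := by ring
      rw [e1, hts]
      field_simp
      ring

/-- Two-sided Bernstein inequality for the empirical measure, in the sub-Gaussian regime
`B ^ 2 * x ≤ n * v`. -/
lemma pi_abs_le_two_mul_exp_neg_of_ae_abs_le {Z : Type*} [MeasurableSpace Z] (P : Measure Z)
    [IsProbabilityMeasure P] {g : Z → ℝ} (hg : AEStronglyMeasurable g P) {B v x : ℝ} {n : ℕ}
    (hn : 0 < n) (hB : ∀ᵐ z ∂P, |g z| ≤ B) (hv : ∫ z, g z ^ 2 ∂P ≤ v) (hv0 : 0 < v)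
    (hx : 0 ≤ x) (hBx : B ^ 2 * x ≤ n * v) :
    (Measure.pi fun _ : Fin n => P)
      {ω | 2 * Real.sqrt (x * v / n) < |(n : ℝ)⁻¹ * ∑ i, g (ω i) - ∫ z, g z ∂P|}
      ≤ ENNReal.ofReal (2 * Real.exp (-x)) := by
  have h1 := pi_real_le_exp_neg_of_ae_abs_le P hg hn hB hv hv0 hx hBx
  have h2 := pi_real_le_exp_neg_of_ae_abs_le P hg.neg hn (by simpa using hB) (by simpa using hv)
    hv0 hx hBx
  rw [ENNReal.le_ofReal_iff_toReal_le (measure_ne_top _ _) (by positivity)]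
  refine le_trans ?_ ((measureReal_union_le _ _).trans
    ((add_le_add h1 h2).trans (two_mul _).ge))
  refine measureReal_mono ?_
  intro ω hω
  rw [Set.mem_ofPred_eq, lt_abs] at hω
  refine hω.imp (fun h => h.le) fun h => ?_
  simp only [Set.mem_ofPred_eq, Pi.neg_apply, Finset.sum_neg_distrib, integral_neg]
  linarith

/-- A function given by a polynomial on each cell of a finite measurable partition of `S` and
vanishing outside `S` is measurable. -/
lemma measurable_of_piecewise_polynomial {ι : Type*} [Finite ι] {I : ι → Set ℝ} {S : Set ℝ}
    (hI : ∀ i, MeasurableSet (I i)) (hcover : (⋃ i, I i) = S) {s : ℝ → ℝ}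
    (hs0 : ∀ x, x ∉ S → s x = 0)
    (hs : ∀ i, ∃ p : Polynomial ℝ, ∀ x ∈ I i, s x = p.eval x) : Measurable s := by
  subst hcover
  intro t ht
  choose p hp using hs
  have : s ⁻¹' t = (⋃ i, I i ∩ (fun x => (p i).eval x) ⁻¹' t) ∪
      ((⋃ i, I i)ᶜ ∩ (fun _ => (0 : ℝ)) ⁻¹' t) := by
    ext x
    by_cases hx : x ∈ ⋃ i, I i
    · simp only [Set.mem_preimage, Set.mem_union, Set.mem_iUnion, Set.mem_inter_iff]
      constructor
      · intro h
        obtain ⟨i, hi⟩ := Set.mem_iUnion.mp hx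
        exact Or.inl ⟨i, hi, by rwa [← hp i x hi]⟩
      · rintro (⟨i, hi, h⟩ | ⟨h, -⟩)
        · rwa [hp i x hi]
        · exact absurd hx h
    · have h' : ∀ i, x ∉ I i := by simpa using hx
      simp [hs0 x hx, h']
  rw [this]
  exact (MeasurableSet.iUnion fun i => (hI i).inter ((p i).continuous.measurable ht)).union
    ((MeasurableSet.iUnion hI).compl.inter (measurable_const ht))

/-- A union bound over a finite family of bad events. -/
lemma ofReal_one_sub_le_measure_forall_notMem {Ω κ : Type*} [MeasurableSpace Ω] (μ : Measure Ω)
    [IsProbabilityMeasure μ] [Fintype κ] (bad : κ → Set Ω) {δ : ℝ} (hδ : 0 ≤ δ)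
    (hbad : ∀ c, μ (bad c) ≤ ENNReal.ofReal δ) :
    ENNReal.ofReal (1 - Fintype.card κ * δ) ≤ μ {ω | ∀ c, ω ∉ bad c} := by
  have hU : μ (⋃ c, bad c) ≤ ENNReal.ofReal (Fintype.card κ * δ) := by
    refine (measure_iUnion_fintype_le μ bad).trans ((Finset.sum_le_sum fun c _ => hbad c).trans ?_)
    rw [Finset.sum_const, Finset.card_univ, nsmul_eq_mul, ENNReal.ofReal_mul (by positivity),
      ENNReal.ofReal_natCast]
  have hcover : (Set.univ : Set Ω) ⊆ {ω | ∀ c, ω ∉ bad c} ∪ ⋃ c, bad c := by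
    intro ω _
    by_cases h : ω ∈ ⋃ c, bad c
    · exact Or.inr h
    · exact Or.inl (by simpa using h)
  have h1 : (1 : ENNReal) ≤ μ {ω | ∀ c, ω ∉ bad c} + ENNReal.ofReal (Fintype.card κ * δ) := by
    rw [← measure_univ (μ := μ)]
    exact (measure_mono hcover).trans ((measure_union_le _ _).trans (by gcongr))
  rw [ENNReal.ofReal_sub _ (by positivity), ENNReal.ofReal_one]
  exact tsub_le_iff_right.mpr h1

/-- A block-diagonal matrix whose rows have `ℓ¹` norm at most `C` has sup-norm operator norm at
most `C`. -/
lemma iSup_abs_sum_mul_le_of_block_diagonal {ι κ : Type*} [Fintype ι] [Fintype κ]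
    [Nonempty (ι × κ)] (a : ι × κ → ι × κ → ℝ) {C : ℝ}
    (hoff : ∀ p q, p.1 ≠ q.1 → a p q = 0) (hrow : ∀ k j, ∑ i, |a (k, j) (k, i)| ≤ C)
    (v : ι × κ → ℝ) : (⨆ p, |∑ q, a p q * v q|) ≤ C * ⨆ p, |v p| := by
  refine ciSup_le fun p => ?_
  have hv : ∀ q, |v q| ≤ ⨆ p, |v p| := fun q =>
    le_ciSup (f := fun p => |v p|) (Set.finite_range _).bddAbove q
  obtain ⟨k, j⟩ := p
  have hsum : ∑ q, a (k, j) q * v q = ∑ i, a (k, j) (k, i) * v (k, i) := by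
    rw [Fintype.sum_prod_type]
    refine Fintype.sum_eq_single k fun l hl => Finset.sum_eq_zero fun i _ => ?_
    rw [hoff (k, j) (l, i) hl.symm, zero_mul]
  rw [hsum]
  calc _ ≤ ∑ i, |a (k, j) (k, i) * v (k, i)| := Finset.abs_sum_le_sum_abs _ _
    _ ≤ ∑ i, |a (k, j) (k, i)| * ⨆ p, |v p| := Finset.sum_le_sum fun i _ => by
        rw [abs_mul]
        exact mul_le_mul_of_nonneg_left (hv _) (abs_nonneg _)
    _ ≤ _ := by
        rw [← Finset.sum_mul]
        exact mul_le_mul_of_nonneg_right (hrow k j) ((abs_nonneg _).trans (hv (k, j)))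

set_option maxHeartbeats 2000000 in
/-- **Control of the random Gram-type matrix for piecewise polynomials**
(Lemma `lemma_sub_consistency_piecewise`). -/
theorem piecewise_polynomials_gram_matrix_control
    (γ A cmin cmax cMLeb Ap Lrc : ℝ) (r : ℕ)
    (hγ : 0 < γ) (hA : 0 < A) (hcmin : 0 < cmin) (hcmax : 0 < cmax)
    (hcMLeb : 0 < cMLeb) (hAp : 0 < Ap) (hLrc : 0 < Lrc) :
    ∃ L : ℝ, 0 < L ∧ ∃ L' : ℝ, 0 < L' ∧ ∃ n₀ : ℕ, ∀ n : ℕ, n₀ ≤ n →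
    ∀ (P : Measure (ℝ × ℝ)) [IsProbabilityMeasure P] (f : ℝ → ℝ)
      (ι : Type) [Fintype ι] [DecidableEq ι] (I : ι → Set ℝ) (M : Set (ℝ → ℝ))
      (φ : ι → Fin (r + 1) → ℝ → ℝ),
    -- `P^X` has density `f` w.r.t. Lebesgue measure on `[0,1]`, with `c_min ≤ f ≤ c_max`
    P.fst = (volume.restrict (Set.Icc (0:ℝ) 1)).withDensity
        (fun x => ENNReal.ofReal (f x)) →
    (∀ x ∈ Set.Icc (0:ℝ) 1, cmin ≤ f x ∧ f x ≤ cmax) →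
    -- `𝒫 = (I i)` is a finite partition of `[0,1]` into measurable intervals
    (∀ i, MeasurableSet (I i)) →
    (∀ i, (I i).OrdConnected) →
    (∀ i, (I i).Nonempty) →
    (∀ i j, i ≠ j → Disjoint (I i) (I j)) →
    ((⋃ i, I i) = Set.Icc (0:ℝ) 1) →
    -- `M` is the model of piecewise polynomials of degree at most `r` on `𝒫`
    (∀ s : ℝ → ℝ, s ∈ M ↔
      ((∀ x, x ∉ Set.Icc (0:ℝ) 1 → s x = 0) ∧
       ∀ i, ∃ p : Polynomial ℝ, p.natDegree ≤ r ∧ ∀ x ∈ I i, s x = p.eval x)) →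
    -- lower regularity of the partition w.r.t. `Leb`
    (∀ i, cMLeb ≤ Real.sqrt ((Fintype.card ι : ℝ) * (volume (I i)).toReal)) →
    -- `|Y| ≤ A` a.s.
    (∀ᵐ z ∂P, |z.2| ≤ A) →
    -- `φ` is the localized orthonormal basis of `(M, L₂(P^X))`
    (∀ k j x, x ∉ I k → φ k j x = 0) →
    (∀ k j, φ k j ∈ M) →
    (∀ k j k' j', (∫ x, φ k j x * φ k' j' x ∂P.fst)
        = if k = k' ∧ j = j' then (1 : ℝ) else 0) →
    (∀ s : ℝ → ℝ, s ∈ M ↔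
        ∃ β : ι → Fin (r + 1) → ℝ, s = fun x => ∑ k, ∑ j, β k j * φ k j x) →
    (∀ k j x, |φ k j x| ≤ Lrc / Real.sqrt ((volume (I k)).toReal)) →
    -- `D = (r+1)|𝒫| ≤ A₊ n (ln n)^{-2}`
    (((r : ℝ) + 1) * Fintype.card ι ≤ Ap * n / Real.log n ^ 2) →
    -- conclusion: on an event `Ω_n` of probability at least `1 - 3Dn^{-γ}` the empirical
    -- Gram-type matrix `L_{n,D}` is controlled
    ∃ Ωn : Set (Fin n → ℝ × ℝ),
      ENNReal.ofReal (1 - 3 * (((r : ℝ) + 1) * Fintype.card ι) * (n : ℝ) ^ (-γ)) ≤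
        (Measure.pi fun _ : Fin n => P) Ωn ∧
      L * Real.sqrt ((((r : ℝ) + 1) * Fintype.card ι) * Real.log n / n) ≤ 1 / 2 ∧
      (∀ k : ι, L * Real.sqrt (Real.log n / (n * (volume (I k)).toReal)) ≤ 1 / 2) ∧
      ∀ ω ∈ Ωn,
        -- (i): `‖L_{n,D}‖ ≤ L √(D ln n/n) (≤ 1/2)`, with `‖·‖` the operator norm
        -- induced by the sup-norm on vectors
        (∀ v : ι × Fin (r + 1) → ℝ,
          (⨆ p : ι × Fin (r + 1),
            |∑ q : ι × Fin (r + 1),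
              ((n : ℝ)⁻¹ * ∑ i, φ p.1 p.2 (ω i).1 * φ q.1 q.2 (ω i).1
                - ∫ x, φ p.1 p.2 x * φ q.1 q.2 x ∂P.fst) * v q|)
            ≤ L * Real.sqrt ((((r : ℝ) + 1) * Fintype.card ι) * Real.log n / n) *
                ⨆ p : ι × Fin (r + 1), |v p|) ∧
        -- (ii): row-wise control on each cell `I_k`
        (∀ (k : ι) (j : Fin (r + 1)),
          ∑ i' : Fin (r + 1),
            |(n : ℝ)⁻¹ * ∑ i, φ k j (ω i).1 * φ k i' (ω i).1
              - ∫ x, φ k j x * φ k i' x ∂P.fst|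
            ≤ L * Real.sqrt (Real.log n / (n * (volume (I k)).toReal))) ∧
        -- (iii): control of the empirical coefficients of `y`
        (∀ (k : ι) (j : Fin (r + 1)),
          |(n : ℝ)⁻¹ * ∑ i, (ω i).2 * φ k j (ω i).1 - ∫ z, z.2 * φ k j z.1 ∂P|
            ≤ L' * Real.sqrt (Real.log n / n)) := by
  set b : ℝ := γ + 1 with hb_def
  have hb : 0 < b := by positivity
  set L₀ : ℝ := 2 * ((r : ℝ) + 1) * Lrc * Real.sqrt b with hL₀_def
  have hL₀ : 0 < L₀ := by positivity
  set L : ℝ := L₀ * (1 + 1 / cMLeb) with hL_def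
  have hL : 0 < L := by positivity
  set K : ℝ := 4 * L ^ 2 * Ap + 4 * L ^ 2 * Ap / cMLeb ^ 2 + Lrc ^ 2 * b * Ap / cMLeb ^ 2 + 1
    with hK_def
  have hK₁ : 4 * L ^ 2 * Ap ≤ K := by
    have : 0 ≤ 4 * L ^ 2 * Ap / cMLeb ^ 2 + Lrc ^ 2 * b * Ap / cMLeb ^ 2 := by positivity
    linarith
  have hK₂ : 4 * L ^ 2 * Ap / cMLeb ^ 2 ≤ K := by
    have : 0 ≤ 4 * L ^ 2 * Ap + Lrc ^ 2 * b * Ap / cMLeb ^ 2 := by positivity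
    linarith
  have hK₃ : Lrc ^ 2 * b * Ap / cMLeb ^ 2 ≤ K := by
    have : 0 ≤ 4 * L ^ 2 * Ap + 4 * L ^ 2 * Ap / cMLeb ^ 2 := by positivity
    linarith
  have hK : 1 ≤ K := by
    have : 0 ≤ 4 * L ^ 2 * Ap + 4 * L ^ 2 * Ap / cMLeb ^ 2
      + Lrc ^ 2 * b * Ap / cMLeb ^ 2 := by positivity
    linarith
  refine ⟨L, hL, 2 * A * Real.sqrt b, by positivity, ⌈Real.exp K⌉₊ + r + 2, ?_⟩
  intro n hn P _ f ι _ _ I M φ _ _ hImeas _ _ hdisj hIcover hM hreg hY hsupp hφM hortho _ hφsup hD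
  have hn0 : 0 < n := by omega
  have hn' : (0 : ℝ) < n := by exact_mod_cast hn0
  have hlogK : K ≤ Real.log n := by
    rw [Real.le_log_iff_exp_le hn']
    exact (Nat.le_ceil _).trans (by exact_mod_cast (by omega : ⌈Real.exp K⌉₊ ≤ n))
  have hlog : 0 < Real.log n := by linarith
  have hrn : (r : ℝ) + 2 ≤ n := by exact_mod_cast (by omega : r + 2 ≤ n)
  set N : ℝ := (Fintype.card ι : ℝ) with hN_def
  have hN : 0 ≤ N := by positivity
  have hDN : ((r : ℝ) + 1) * N * Real.log n / n ≤ Ap / Real.log n := by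
    rw [le_div_iff₀ (by positivity)] at hD
    rw [div_le_div_iff₀ hn' hlog]
    linarith
  have hND : N * Real.log n / n ≤ Ap / Real.log n := by
    refine le_trans ?_ hDN
    gcongr
    nlinarith [mul_nonneg (Nat.cast_nonneg (α := ℝ) r) hN]
  have hNe : Nonempty ι := by
    by_contra h
    rw [not_nonempty_iff] at h
    have : (0 : ℝ) ∈ ⋃ i, I i := hIcover ▸ ⟨le_rfl, zero_le_one⟩
    simp at this
  set ℓ : ι → ℝ := fun k => (volume (I k)).toReal
  have hreg' : ∀ k, cMLeb ^ 2 ≤ N * ℓ k := fun k =>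
    (Real.le_sqrt' hcMLeb).mp (hreg k)
  have hℓ : ∀ k, 0 < ℓ k := fun k =>
    pos_of_mul_pos_right ((pow_pos hcMLeb 2).trans_le (hreg' k)) hN
  have hcell : ∀ k, Real.log n / (n * ℓ k) ≤ N * Real.log n / n / cMLeb ^ 2 := fun k => by
    rw [div_div, div_le_div_iff₀ (mul_pos hn' (hℓ k)) (by positivity)]
    nlinarith [mul_le_mul_of_nonneg_left (hreg' k) (mul_pos hlog hn').le]
  have hcell' : ∀ k, Real.log n / (n * ℓ k) ≤ Ap / Real.log n / cMLeb ^ 2 := fun k =>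
    (hcell k).trans (by gcongr)
  have half : ∀ {u : ℝ}, 4 * L ^ 2 * u ≤ 1 → L * Real.sqrt u ≤ 1 / 2 := fun {u} hu => by
    have h1 : Real.sqrt u ≤ 1 / (2 * L) := by
      refine Real.sqrt_le_iff.mpr ⟨by positivity, ?_⟩
      rw [div_pow, le_div_iff₀ (by positivity)]
      linarith
    calc L * Real.sqrt u ≤ L * (1 / (2 * L)) := by gcongr
      _ = 1 / 2 := by field_simp
  have hφmeas : ∀ k j, Measurable (φ k j) := fun k j => by
    obtain ⟨h0, hp⟩ := (hM _).mp (hφM k j)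
    exact measurable_of_piecewise_polynomial hImeas hIcover h0 fun i =>
      (hp i).imp fun p hp => hp.2
  have hfst : ∀ g : ℝ → ℝ, Measurable g → ∫ z, g z.1 ∂P = ∫ x, g x ∂P.fst := fun g hg =>
    (integral_map measurable_fst.aemeasurable hg.aestronglyMeasurable).symm
  have hφbound : ∀ k j x, |φ k j x| ^ 2 ≤ Lrc ^ 2 / ℓ k := fun k j x => by
    have := pow_le_pow_left₀ (abs_nonneg _) (hφsup k j x) 2
    rwa [div_pow, Real.sq_sqrt (hℓ k).le] at this
  have hφone : ∀ k j, ∫ z, φ k j z.1 ^ 2 ∂P = 1 := fun k j => by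
    rw [hfst (fun x => φ k j x ^ 2) ((hφmeas k j).pow_const 2)]
    simpa [pow_two] using hortho k j k j
  have hφint : ∀ k j, Integrable (fun z : ℝ × ℝ => φ k j z.1 ^ 2) P := fun k j =>
    Integrable.of_integral_ne_zero (by rw [hφone]; exact one_ne_zero)
  set x : ℝ := b * Real.log n with hx_def
  have hx : 0 ≤ x := by positivity
  have hxsmall : ∀ k, Lrc ^ 2 / ℓ k * x ≤ n := fun k => by
    have h1 := hcell' k
    have h2 : Lrc ^ 2 * b * (Ap / Real.log n / cMLeb ^ 2) ≤ 1 := by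
      rw [show Lrc ^ 2 * b * (Ap / Real.log n / cMLeb ^ 2)
        = Lrc ^ 2 * b * Ap / cMLeb ^ 2 / Real.log n by ring]
      exact (div_le_one hlog).mpr (hK₃.trans hlogK)
    have h3 : Lrc ^ 2 * b * (Real.log n / (n * ℓ k)) ≤ 1 :=
      (mul_le_mul_of_nonneg_left h1 (by positivity)).trans h2
    have h4 : Lrc ^ 2 / ℓ k * x = Lrc ^ 2 * b * (Real.log n / (n * ℓ k)) * n := by
      have := hℓ k
      rw [hx_def]
      field_simp
    rw [h4]
    nlinarith
  set μ : Measure (Fin n → ℝ × ℝ) := Measure.pi fun _ : Fin n => P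
  have hgram : ∀ c : ι × Fin (r + 1) × Fin (r + 1),
      μ {ω | 2 * Real.sqrt (x * (Lrc ^ 2 / ℓ c.1) / n) <
        |(n : ℝ)⁻¹ * ∑ i, φ c.1 c.2.1 (ω i).1 * φ c.1 c.2.2 (ω i).1
          - ∫ x, φ c.1 c.2.1 x * φ c.1 c.2.2 x ∂P.fst|}
        ≤ ENNReal.ofReal (2 * Real.exp (-x)) := by
    rintro ⟨k, j, j'⟩
    have hℓk := hℓ k
    have hmeas : Measurable fun x => φ k j x * φ k j' x := (hφmeas k j).mul (hφmeas k j')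
    rw [← hfst _ hmeas]
    refine pi_abs_le_two_mul_exp_neg_of_ae_abs_le P (B := Lrc ^ 2 / ℓ k)
      (g := fun z => φ k j z.1 * φ k j' z.1)
      (hmeas.comp measurable_fst).aestronglyMeasurable hn0 ?_ ?_ (by positivity) hx ?_
    · refine .of_forall fun z => ?_
      rw [abs_mul]
      nlinarith [hφbound k j z.1, hφbound k j' z.1, sq_nonneg (|φ k j z.1| - |φ k j' z.1|)]
    · calc ∫ z, (φ k j z.1 * φ k j' z.1) ^ 2 ∂P
          ≤ ∫ z, Lrc ^ 2 / ℓ k * φ k j' z.1 ^ 2 ∂P := by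
            refine integral_mono_of_nonneg (.of_forall fun z => by positivity)
              ((hφint k j').const_mul _) (.of_forall fun z => ?_)
            simp only [mul_pow]
            gcongr
            rw [← sq_abs]
            exact hφbound k j z.1
        _ = Lrc ^ 2 / ℓ k := by rw [integral_const_mul, hφone, mul_one]
    · have := mul_le_mul_of_nonneg_left (hxsmall k) (by positivity : 0 ≤ Lrc ^ 2 / ℓ k)
      nlinarith
  have hresp : ∀ c : ι × Fin (r + 1),
      μ {ω | 2 * Real.sqrt (x * A ^ 2 / n) <
        |(n : ℝ)⁻¹ * ∑ i, (ω i).2 * φ c.1 c.2 (ω i).1 - ∫ z, z.2 * φ c.1 c.2 z.1 ∂P|}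
        ≤ ENNReal.ofReal (2 * Real.exp (-x)) := by
    rintro ⟨k, j⟩
    have hℓk := hℓ k
    refine pi_abs_le_two_mul_exp_neg_of_ae_abs_le P (B := A * (Lrc / Real.sqrt (ℓ k)))
      (g := fun z => z.2 * φ k j z.1)
      (measurable_snd.mul ((hφmeas k j).comp measurable_fst)).aestronglyMeasurable hn0
      ?_ ?_ (by positivity) hx ?_
    · filter_upwards [hY] with z hz
      rw [abs_mul]
      exact mul_le_mul hz (hφsup k j z.1) (abs_nonneg _) hA.le
    · calc ∫ z, (z.2 * φ k j z.1) ^ 2 ∂P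
          ≤ ∫ z, A ^ 2 * φ k j z.1 ^ 2 ∂P := by
            refine integral_mono_of_nonneg (.of_forall fun z => by positivity)
              ((hφint k j).const_mul _) ?_
            filter_upwards [hY] with z hz
            rw [mul_pow]
            refine mul_le_mul_of_nonneg_right ?_ (sq_nonneg _)
            rw [← sq_abs]
            exact pow_le_pow_left₀ (abs_nonneg _) hz 2
        _ = A ^ 2 := by rw [integral_const_mul, hφone, mul_one]
    · rw [mul_pow, div_pow, Real.sq_sqrt hℓk.le]
      have := mul_le_mul_of_nonneg_left (hxsmall k) (sq_nonneg A)
      nlinarith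
  have hprob := ofReal_one_sub_le_measure_forall_notMem μ (Sum.elim _ _)
    (by positivity : 0 ≤ 2 * Real.exp (-x)) (Sum.forall.mpr ⟨hgram, hresp⟩)
  refine ⟨_, le_trans (ENNReal.ofReal_le_ofReal ?_) hprob, ?_, fun k => ?_, fun ω hω => ?_⟩
  · have hexp : Real.exp (-x) = (n : ℝ) ^ (-γ) / n := by
      rw [Real.rpow_def_of_pos hn', hx_def, hb_def,
        show -((γ + 1) * Real.log n) = Real.log n * -γ - Real.log n by ring, Real.exp_sub,
        Real.exp_log hn']
    have hpos : 0 ≤ (n : ℝ) ^ (-γ) := by positivity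
    simp only [Fintype.card_sum, Fintype.card_prod, Fintype.card_fin]
    push_cast
    rw [hexp, ← hN_def]
    have : (N * (((r : ℝ) + 1) * (r + 1)) + N * (r + 1)) * (2 * ((n : ℝ) ^ (-γ) / n))
        = 2 * ((r + 1) * N) * (n : ℝ) ^ (-γ) * ((r + 2) / n) := by ring
    rw [this]
    have h1 : ((r : ℝ) + 2) / n ≤ 1 := (div_le_one hn').mpr hrn
    have h2 : 0 ≤ ((r : ℝ) + 1) * N * (n : ℝ) ^ (-γ) := by positivity
    nlinarith
  · refine half ((mul_le_mul_of_nonneg_left hDN (by positivity)).trans ?_)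
    rw [← mul_div_assoc]
    exact (div_le_one hlog).mpr (hK₁.trans hlogK)
  · refine half ((mul_le_mul_of_nonneg_left (hcell' k) (by positivity)).trans ?_)
    rw [show 4 * L ^ 2 * (Ap / Real.log n / cMLeb ^ 2)
      = 4 * L ^ 2 * Ap / cMLeb ^ 2 / Real.log n by ring]
    exact (div_le_one hlog).mpr (hK₂.trans hlogK)
  · have hω₁ : ∀ k j j', |(n : ℝ)⁻¹ * ∑ i, φ k j (ω i).1 * φ k j' (ω i).1
          - ∫ x, φ k j x * φ k j' x ∂P.fst| ≤ 2 * Real.sqrt (x * (Lrc ^ 2 / ℓ k) / n) :=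
      fun k j j' => not_lt.mp (hω (Sum.inl (k, j, j')))
    have hω₂ : ∀ k j, |(n : ℝ)⁻¹ * ∑ i, (ω i).2 * φ k j (ω i).1 - ∫ z, z.2 * φ k j z.1 ∂P|
          ≤ 2 * Real.sqrt (x * A ^ 2 / n) :=
      fun k j => not_lt.mp (hω (Sum.inr (k, j)))
    have hrow : ∀ (k : ι) (j : Fin (r + 1)), ∑ i' : Fin (r + 1),
        |(n : ℝ)⁻¹ * ∑ i, φ k j (ω i).1 * φ k i' (ω i).1 - ∫ x, φ k j x * φ k i' x ∂P.fst|
        ≤ L₀ * Real.sqrt (Real.log n / (n * ℓ k)) := fun k j => by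
      refine (Finset.sum_le_sum fun i' _ => hω₁ k j i').trans_eq ?_
      have : x * (Lrc ^ 2 / ℓ k) / n = Lrc ^ 2 * (b * (Real.log n / (n * ℓ k))) := by
        rw [hx_def]; ring
      rw [this, Real.sqrt_mul (sq_nonneg _), Real.sqrt_sq hLrc.le, Real.sqrt_mul hb.le,
        Finset.sum_const, Finset.card_univ, Fintype.card_fin, nsmul_eq_mul, hL₀_def]
      push_cast
      ring
    refine ⟨?_, fun k j => (hrow k j).trans ?_, fun k j => (hω₂ k j).trans_eq ?_⟩
    · refine iSup_abs_sum_mul_le_of_block_diagonal (fun p q : ι × Fin (r + 1) =>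
        (n : ℝ)⁻¹ * ∑ i, φ p.1 p.2 (ω i).1 * φ q.1 q.2 (ω i).1
          - ∫ x, φ p.1 p.2 x * φ q.1 q.2 x ∂P.fst) ?_ fun k j => (hrow k j).trans ?_
      · intro p q hpq
        have hzero : ∀ x, φ p.1 p.2 x * φ q.1 q.2 x = 0 := fun x => by
          by_cases hxp : x ∈ I p.1
          · rw [hsupp q.1 q.2 x fun hxq => Set.disjoint_left.mp (hdisj _ _ hpq) hxp hxq, mul_zero]
          · rw [hsupp p.1 p.2 x hxp, zero_mul]
        simp [hzero]
      · have h1 : Real.sqrt (Real.log n / (n * ℓ k))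
            ≤ Real.sqrt (((r : ℝ) + 1) * N * Real.log n / n) * (1 / cMLeb) := by
          refine Real.sqrt_le_iff.mpr ⟨by positivity, ?_⟩
          rw [mul_pow, Real.sq_sqrt (by positivity), div_pow, one_pow, mul_one_div]
          refine (hcell k).trans ?_
          gcongr
          nlinarith [mul_nonneg (Nat.cast_nonneg (α := ℝ) r) hN]
        have h2 := mul_le_mul_of_nonneg_left h1 hL₀.le
        have h3 : 0 ≤ L₀ * Real.sqrt (((r : ℝ) + 1) * N * Real.log n / n) := by positivity
        rw [hL_def]
        linarith
    · gcongr
      rw [hL_def]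
      exact le_mul_of_one_le_right hL₀.le (by simp [hcMLeb.le])
    · have : x * A ^ 2 / n = A ^ 2 * (b * (Real.log n / n)) := by rw [hx_def]; ring
      rw [this, Real.sqrt_mul (sq_nonneg _), Real.sqrt_sq hA.le, Real.sqrt_mul hb.le]
      ring
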